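/- arXiv:2204.14089 — 8 statements merged into one kernel-verified Lean document; each statement's English description precedes it below -/
import Mathlib

section
/- Let x_p ∈ ℝ², let δ > 0, let x_1,…,x_k be points in the closed ball of radius δ centered at x_p, let w_1,…,w_k ∈ ℝ, and let m, n ≥ 0 and N > m + n be integers. Suppose the weights satisfy the moment conditions of order N for the derivative D^{m,n} at x_p. Then for every function f : ℝ² → ℝ that is N times continuously differentiable on the closed ball B(x_p, δ), the approximation error satisfies |Σ_{q=1}^{k} w_q f(x_q) − (∂^{m+n} f / ∂x^m ∂y^n)(x_p)| ≤ (Σ_{q=1}^{k} |w_q|) · (δ^N / N!) · sup_{y ∈ B(x_p,δ)} ‖D^N f(y)‖, where ‖D^N f(y)‖ denotes the operator norm of the N-th (iterated Fréchet) derivative of f at y. In particular the discrete derivative operator is consistent of order N − m − n in the ball radius δ. -/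
open Metric Finset

section Symmetry

variable {E F : Type*} [NormedAddCommGroup E] [NormedSpace ℝ E]
  [NormedAddCommGroup F] [NormedSpace ℝ F] {f : E → F} {x : E}

theorem iteratedFDeriv_add_two_apply {n : ℕ} (hf : ContDiffAt ℝ (n + 2 : ℕ) f x)
    (v : Fin (n + 2) → E) :
    iteratedFDeriv ℝ (n + 2) f x v =
      fderiv ℝ (fderiv ℝ (iteratedFDeriv ℝ n f)) x (v 0) (v 1) (Fin.tail (Fin.tail v)) := by
  have hG : ContDiffAt ℝ 2 (iteratedFDeriv ℝ n f) x :=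
    hf.iteratedFDeriv_right (by norm_cast; omega)
  have hG' : DifferentiableAt ℝ (fderiv ℝ (iteratedFDeriv ℝ n f)) x :=
    (hG.fderiv_right (m := 1) (by norm_num)).differentiableAt (by norm_num)
  have hd : DifferentiableAt ℝ (iteratedFDeriv ℝ (n + 1) f) x :=
    hf.differentiableAt_iteratedFDeriv (by norm_cast; omega)
  rw [hd.iteratedFDeriv_succ_apply_left']
  have h := (hG'.hasFDerivAt.clm_apply
    (hasFDerivAt_const (v 1) x)).continuousMultilinear_apply_const (Fin.tail (Fin.tail v))
  change fderiv ℝ (fun y => fderiv ℝ (iteratedFDeriv ℝ n f) y (v 1) (Fin.tail (Fin.tail v))) x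
    (v 0) = _
  rw [h.fderiv]
  simp

theorem ContDiffAt.iteratedFDeriv_comp_swap_castSucc_succ {n : ℕ} (i : Fin n)
    (hf : ContDiffAt ℝ (n + 1 : ℕ) f x) (v : Fin (n + 1) → E) :
    iteratedFDeriv ℝ (n + 1) f x (v ∘ Equiv.swap i.castSucc i.succ) =
      iteratedFDeriv ℝ (n + 1) f x v := by
  induction n generalizing x with
  | zero => exact i.elim0
  | succ n ih =>
    cases i using Fin.cases with
    | zero =>
      rw [iteratedFDeriv_add_two_apply hf, iteratedFDeriv_add_two_apply hf]
      have hG : ContDiffAt ℝ 2 (iteratedFDeriv ℝ n f) x :=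
        hf.iteratedFDeriv_right (by norm_cast; omega)
      have htail : Fin.tail (Fin.tail (v ∘ Equiv.swap (0 : Fin (n + 2)) 1)) =
          Fin.tail (Fin.tail v) := by
        ext j
        simp only [Fin.tail, Function.comp_apply]
        rw [Equiv.swap_apply_of_ne_of_ne (Fin.succ_ne_zero _)
          (by simp [Fin.ext_iff])]
      simp only [Fin.castSucc_zero, Fin.succ_zero_eq_one, htail, Function.comp_apply,
        Equiv.swap_apply_left, Equiv.swap_apply_right]
      rw [(hG.isSymmSndFDerivAt (by simp)).eq]
    | succ j =>
      have hd : DifferentiableAt ℝ (iteratedFDeriv ℝ (n + 1) f) x :=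
        hf.differentiableAt_iteratedFDeriv (by norm_cast; omega)
      rw [hd.iteratedFDeriv_succ_apply_left', hd.iteratedFDeriv_succ_apply_left']
      have h0 : (v ∘ Equiv.swap j.succ.castSucc j.succ.succ) 0 = v 0 := by
        rw [Function.comp_apply, Equiv.swap_apply_of_ne_of_ne
          (by simp [Fin.ext_iff]) (by simp [Fin.ext_iff])]
      have htail : Fin.tail (v ∘ Equiv.swap j.succ.castSucc j.succ.succ) =
          Fin.tail v ∘ Equiv.swap j.castSucc j.succ := by
        ext l
        simp only [Fin.tail, Function.comp_apply, ← Fin.succ_castSucc]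
        rw [← (Fin.succ_injective _).map_swap]
      rw [h0, htail]
      congr 1
      apply Filter.EventuallyEq.fderiv_eq
      filter_upwards [hf.eventually (by simp)] with y hy
      exact ih j (hy.of_le (by norm_cast; omega)) _

/-- The `n`-th iterated derivative of a `C^n` function is symmetric. -/
theorem ContDiffAt.iteratedFDeriv_comp_perm_of_real {n : ℕ} (hf : ContDiffAt ℝ n f x)
    (v : Fin n → E) (σ : Equiv.Perm (Fin n)) :
    iteratedFDeriv ℝ n f x (v ∘ σ) = iteratedFDeriv ℝ n f x v := by
  cases n with
  | zero => congr 1; exact Subsingleton.elim _ _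
  | succ n =>
    have hσ : σ ∈ Submonoid.closure
        (Set.range fun i : Fin n => Equiv.swap i.castSucc i.succ) := by
      simp [Equiv.Perm.mclosure_swap_castSucc_succ]
    induction hσ using Submonoid.closure_induction generalizing v with
    | mem τ hτ =>
      obtain ⟨i, rfl⟩ := hτ
      exact hf.iteratedFDeriv_comp_swap_castSucc_succ i v
    | one => rfl
    | mul σ τ _ _ hσ hτ =>
      rw [Equiv.Perm.coe_mul, ← Function.comp_assoc, hτ, hσ]

theorem ContDiffAt.iteratedFDeriv_piecewise_eq_of_card_eq {n : ℕ} (hf : ContDiffAt ℝ n f x)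
    (a b : E) {s t : Finset (Fin n)} (hst : #s = #t) :
    iteratedFDeriv ℝ n f x (s.piecewise (fun _ => a) fun _ => b) =
      iteratedFDeriv ℝ n f x (t.piecewise (fun _ => a) fun _ => b) := by
  obtain ⟨σ, rfl⟩ := Equiv.Perm.exists_map_finset_eq s t hst
  rw [← hf.iteratedFDeriv_comp_perm_of_real _ σ.symm]
  congr 1
  ext i
  simp [Finset.piecewise]

end Symmetry

section Taylor

variable {E : Type*} [NormedAddCommGroup E] [NormedSpace ℝ E] {f : E → ℝ} {s : Set E}

theorem ContDiffOn.iteratedDerivWithin_comp_add_smul {N : ℕ} (hf : ContDiffOn ℝ N f s)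
    (hs : UniqueDiffOn ℝ s) {x v : E}
    (hmaps : Set.MapsTo (fun t : ℝ => x + t • v) (Set.Icc 0 1) s) {i : ℕ} (hi : i ≤ N)
    {t : ℝ} (ht : t ∈ Set.Icc (0 : ℝ) 1) :
    iteratedDerivWithin i (fun t : ℝ => f (x + t • v)) (Set.Icc 0 1) t =
      iteratedFDerivWithin ℝ i f s (x + t • v) fun _ => v := by
  induction i generalizing t with
  | zero => simp
  | succ i ih =>
    rw [iteratedDerivWithin_succ, derivWithin_congr (fun r hr => ih (by omega) hr)
      (ih (by omega) ht)]
    have hd : HasFDerivWithinAt (iteratedFDerivWithin ℝ i f s) _ s (x + t • v) :=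
      (hf.differentiableOn_iteratedFDerivWithin (by norm_cast) hs _
        (hmaps ht)).hasFDerivWithinAt
    have hline : HasDerivWithinAt (fun t : ℝ => x + t • v) v (Set.Icc 0 1) t := by
      simpa using (((hasDerivAt_id t).smul_const v).const_add x).hasDerivWithinAt
    exact ((hd.continuousMultilinear_apply_const fun _ => v).comp_hasDerivWithinAt t hline
      hmaps).derivWithin (uniqueDiffOn_Icc zero_lt_one t ht)

/-- **Taylor's inequality** on a convex set, along the segment from `x` to `x + v`. -/
theorem ContDiffOn.abs_sub_sum_iteratedFDerivWithin_le {N : ℕ} (hN : N ≠ 0)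
    (hf : ContDiffOn ℝ N f s) (hs : UniqueDiffOn ℝ s) (hconv : Convex ℝ s) {x v : E}
    (hx : x ∈ s) (hv : x + v ∈ s) {C : ℝ} (hC : ∀ y ∈ s, ‖iteratedFDerivWithin ℝ N f s y‖ ≤ C) :
    |f (x + v) - ∑ i ∈ range N,
        (i.factorial : ℝ)⁻¹ * iteratedFDerivWithin ℝ i f s x fun _ => v| ≤
      C * ‖v‖ ^ N / N.factorial := by
  obtain ⟨n, rfl⟩ := Nat.exists_eq_succ_of_ne_zero hN
  have hmaps : Set.MapsTo (fun t : ℝ => x + t • v) (Set.Icc 0 1) s :=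
    fun t ht => hconv.add_smul_mem hx hv ht
  have hg : ContDiffOn ℝ (n + 1 : ℕ) (fun t : ℝ => f (x + t • v)) (Set.Icc 0 1) :=
    hf.comp (by fun_prop) hmaps
  have hI : Set.uIcc (0 : ℝ) 1 = Set.Icc 0 1 := Set.uIcc_of_le zero_le_one
  have hIoo : Set.uIoo (0 : ℝ) 1 = Set.Ioo 0 1 := Set.uIoo_of_le zero_le_one
  obtain ⟨ξ, hξ, h⟩ := taylor_mean_remainder_lagrange (f := fun t : ℝ => f (x + t • v))
    (x₀ := 0) (x := 1) (n := n) zero_ne_one (hI ▸ hg.of_le (by norm_cast; omega))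
    (by
      rw [hI, hIoo]
      exact (hg.differentiableOn_iteratedDerivWithin (by norm_cast; omega)
        (uniqueDiffOn_Icc zero_lt_one)).mono Set.Ioo_subset_Icc_self)
  rw [hIoo] at hξ
  have hξ' := Set.Ioo_subset_Icc_self hξ
  rw [hI, taylor_within_apply, hf.iteratedDerivWithin_comp_add_smul hs hmaps le_rfl hξ'] at h
  have hsum : ∑ i ∈ range (n + 1), (i.factorial : ℝ)⁻¹ *
      iteratedFDerivWithin ℝ i f s x (fun _ => v) =
      ∑ i ∈ range (n + 1), ((i.factorial : ℝ)⁻¹ * (1 - 0) ^ i) •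
        iteratedDerivWithin i (fun t : ℝ => f (x + t • v)) (Set.Icc 0 1) 0 := by
    refine sum_congr rfl fun i hi => ?_
    rw [hf.iteratedDerivWithin_comp_add_smul hs hmaps (mem_range.1 hi).le (by simp)]
    simp
  rw [Nat.succ_eq_add_one, hsum]
  simp only [one_smul] at h
  rw [h, abs_div, Nat.abs_cast]
  gcongr
  rw [sub_zero, one_pow, mul_one, ← Real.norm_eq_abs]
  calc ‖iteratedFDerivWithin ℝ (n + 1) f s (x + ξ • v) fun _ => v‖
      ≤ ‖iteratedFDerivWithin ℝ (n + 1) f s (x + ξ • v)‖ * ∏ _i : Fin (n + 1), ‖v‖ :=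
        ContinuousMultilinearMap.le_opNorm _ _
    _ ≤ C * ‖v‖ ^ (n + 1) := by
        rw [prod_const, card_univ, Fintype.card_fin]
        gcongr
        exact hC _ (hmaps hξ')

end Taylor

section Moments

theorem ContinuousMultilinearMap.apply_const_euclideanSpace_two {l : ℕ}
    (T : ContinuousMultilinearMap ℝ (fun _ : Fin l => EuclideanSpace ℝ (Fin 2)) ℝ)
    (v : EuclideanSpace ℝ (Fin 2)) :
    T (fun _ => v) = ∑ s : Finset (Fin l), v 0 ^ #s * v 1 ^ (l - #s) *
      T (s.piecewise (fun _ => EuclideanSpace.single 0 1) fun _ => EuclideanSpace.single 1 1) := by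
  have hv : (fun _ : Fin l => v) =
      (fun _ => v 0 • EuclideanSpace.single (0 : Fin 2) (1 : ℝ)) +
        fun _ => v 1 • EuclideanSpace.single (1 : Fin 2) (1 : ℝ) := by
    ext i j
    fin_cases j <;> simp
  rw [hv, T.map_add_univ]
  refine sum_congr rfl fun s _ => ?_
  have hs : s.piecewise (fun _ => v 0 • EuclideanSpace.single (0 : Fin 2) (1 : ℝ))
      (fun _ => v 1 • EuclideanSpace.single (1 : Fin 2) (1 : ℝ)) =
      fun i => s.piecewise (fun _ => v 0) (fun _ => v 1) i •
        s.piecewise (fun _ => EuclideanSpace.single (0 : Fin 2) (1 : ℝ))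
          (fun _ => EuclideanSpace.single 1 1) i := by
    ext i
    by_cases hi : i ∈ s <;> simp [hi]
  rw [hs, T.map_smul_univ, prod_piecewise, smul_eq_mul]
  simp [← compl_eq_univ_sdiff, card_compl]

variable {k m n N : ℕ} {u : Fin k → EuclideanSpace ℝ (Fin 2)} {w : Fin k → ℝ}

theorem sum_weight_mul_apply_const (hmom : ∀ i j : ℕ, i + j < N →
      ∑ q, u q 0 ^ i * u q 1 ^ j * w q =
        if i = m ∧ j = n then ((m.factorial : ℝ) * (n.factorial : ℝ)) else 0)
    {l : ℕ} (hl : l < N)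
    (T : ContinuousMultilinearMap ℝ (fun _ : Fin l => EuclideanSpace ℝ (Fin 2)) ℝ) :
    ∑ q, w q * T (fun _ => u q) = ∑ s : Finset (Fin l),
      (if #s = m ∧ l - #s = n then ((m.factorial : ℝ) * (n.factorial : ℝ)) else 0) *
      T (s.piecewise (fun _ => EuclideanSpace.single 0 1) fun _ => EuclideanSpace.single 1 1) := by
  simp_rw [T.apply_const_euclideanSpace_two, mul_sum]
  rw [sum_comm]
  refine sum_congr rfl fun s _ => ?_
  have hs : #s ≤ l := by simpa using card_le_univ s
  rw [← hmom _ _ (by omega), sum_mul]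
  exact sum_congr rfl fun q _ => by ring

theorem sum_weight_mul_apply_const_of_ne (hmom : ∀ i j : ℕ, i + j < N →
      ∑ q, u q 0 ^ i * u q 1 ^ j * w q =
        if i = m ∧ j = n then ((m.factorial : ℝ) * (n.factorial : ℝ)) else 0)
    {l : ℕ} (hl : l < N) (hlmn : l ≠ m + n)
    (T : ContinuousMultilinearMap ℝ (fun _ : Fin l => EuclideanSpace ℝ (Fin 2)) ℝ) :
    ∑ q, w q * T (fun _ => u q) = 0 := by
  rw [sum_weight_mul_apply_const hmom hl]
  refine sum_eq_zero fun s _ => ?_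
  have hs : #s ≤ l := by simpa using card_le_univ s
  rw [if_neg (by omega), zero_mul]

theorem sum_weight_mul_apply_const_add (hmom : ∀ i j : ℕ, i + j < N →
      ∑ q, u q 0 ^ i * u q 1 ^ j * w q =
        if i = m ∧ j = n then ((m.factorial : ℝ) * (n.factorial : ℝ)) else 0)
    (hmn : m + n < N)
    (T : ContinuousMultilinearMap ℝ (fun _ : Fin (m + n) => EuclideanSpace ℝ (Fin 2)) ℝ)
    {c : ℝ} (hT : ∀ s : Finset (Fin (m + n)), #s = m →
      T (s.piecewise (fun _ => EuclideanSpace.single 0 1)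
        fun _ => EuclideanSpace.single 1 1) = c) :
    ∑ q, w q * T (fun _ => u q) = (m + n).factorial * c := by
  rw [sum_weight_mul_apply_const hmom hmn]
  have h : ∀ s : Finset (Fin (m + n)),
      (if #s = m ∧ m + n - #s = n then ((m.factorial : ℝ) * (n.factorial : ℝ)) else 0) *
        T (s.piecewise (fun _ => EuclideanSpace.single 0 1)
          fun _ => EuclideanSpace.single 1 1) =
      if #s = m then (m.factorial : ℝ) * n.factorial * c else 0 := by
    intro s
    by_cases hs : #s = m
    · simp [hs, hT s hs]
    · simp [hs]
  rw [sum_congr rfl fun s _ => h s, ← sum_filter, sum_const, univ_filter_card_eq,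
    card_powersetCard, card_univ, Fintype.card_fin, nsmul_eq_mul,
    Nat.choose_symm_add, ← Nat.add_choose_mul_factorial_mul_factorial m n]
  push_cast
  ring

end Moments

/-- **Consistency of the DC PSE operator.**
If the points `x q` lie in the closed ball of radius `δ` about `xp` and the
weights satisfy the moment conditions of order `N` for the derivative
`D^{m,n}` at `xp`, then for every function `f` that is `N` times continuously
differentiable on the closed ball, the discrete operator approximates the
mixed partial derivative `∂^{m+n} f / ∂x^m ∂y^n (xp)` (encoded as the `N`-th
iterated Fréchet derivative applied to `m` copies of `e₀` and `n` copies of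
`e₁`) with error at most `(∑ |w q|) · δ^N / N! · sup_{B(xp,δ)} ‖D^N f‖`. -/
theorem dcpse_consistency
    (k m n N : ℕ) (hN : m + n < N) (δ : ℝ) (hδ : 0 < δ)
    (xp : EuclideanSpace ℝ (Fin 2)) (x : Fin k → EuclideanSpace ℝ (Fin 2))
    (hx : ∀ q, x q ∈ closedBall xp δ) (w : Fin k → ℝ)
    (hmom : ∀ i j : ℕ, i + j < N →
      ∑ q, (x q 0 - xp 0) ^ i * (x q 1 - xp 1) ^ j * w q =
        if i = m ∧ j = n then ((m.factorial : ℝ) * (n.factorial : ℝ)) else 0)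
    (f : EuclideanSpace ℝ (Fin 2) → ℝ)
    (hf : ContDiffOn ℝ N f (closedBall xp δ)) :
    |∑ q, w q * f (x q) -
        iteratedFDerivWithin ℝ (m + n) f (closedBall xp δ) xp
          (fun i : Fin (m + n) =>
            if (i : ℕ) < m then EuclideanSpace.single (0 : Fin 2) (1 : ℝ)
            else EuclideanSpace.single (1 : Fin 2) (1 : ℝ))| ≤
      (∑ q, |w q|) * (δ ^ N / N.factorial) *
        ⨆ y : closedBall xp δ,
          ‖iteratedFDerivWithin ℝ N f (closedBall xp δ) (y : EuclideanSpace ℝ (Fin 2))‖ := by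
  set B := closedBall xp δ
  have hconv : Convex ℝ B := convex_closedBall xp δ
  have hB : UniqueDiffOn ℝ B := uniqueDiffOn_convex hconv
    ⟨xp, mem_interior_iff_mem_nhds.2 (closedBall_mem_nhds xp hδ)⟩
  have hxp : xp ∈ B := mem_closedBall_self hδ.le
  set M := ⨆ y : B, ‖iteratedFDerivWithin ℝ N f B (y : EuclideanSpace ℝ (Fin 2))‖
  have hbdd : BddAbove (Set.range fun y : B =>
      ‖iteratedFDerivWithin ℝ N f B (y : EuclideanSpace ℝ (Fin 2))‖) := by
    rw [← Set.image_eq_range (fun y => ‖iteratedFDerivWithin ℝ N f B y‖)]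
    exact (isCompact_closedBall xp δ).bddAbove_image
      (hf.continuousOn_iteratedFDerivWithin le_rfl hB).norm
  have hM : ∀ y ∈ B, ‖iteratedFDerivWithin ℝ N f B y‖ ≤ M :=
    fun y hy => le_ciSup hbdd ⟨y, hy⟩
  set P : Fin k → ℝ := fun q => ∑ l ∈ range N,
    (l.factorial : ℝ)⁻¹ * iteratedFDerivWithin ℝ l f B xp fun _ => x q - xp
  have hrem : ∀ q, |f (x q) - P q| ≤ δ ^ N / N.factorial * M := by
    intro q
    have h := hf.abs_sub_sum_iteratedFDerivWithin_le (by omega) hB hconv hxp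
      (v := x q - xp) (by simpa using hx q) hM
    rw [add_sub_cancel] at h
    refine h.trans ?_
    have hM0 : 0 ≤ M := (norm_nonneg _).trans (hM xp hxp)
    rw [div_mul_eq_mul_div, mul_comm]
    gcongr
    exact mem_closedBall_iff_norm.1 (hx q)
  have hfxp : ContDiffAt ℝ (m + n : ℕ) f xp :=
    (hf.contDiffAt (closedBall_mem_nhds xp hδ)).of_le (by norm_cast; omega)
  have hD : iteratedFDerivWithin ℝ (m + n) f B xp = iteratedFDeriv ℝ (m + n) f xp :=
    iteratedFDerivWithin_eq_iteratedFDeriv hB hfxp hxp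
  set e : Fin (m + n) → EuclideanSpace ℝ (Fin 2) := fun i =>
    if (i : ℕ) < m then EuclideanSpace.single (0 : Fin 2) (1 : ℝ)
    else EuclideanSpace.single (1 : Fin 2) (1 : ℝ)
  have he : e = (univ.filter fun i : Fin (m + n) => (i : ℕ) < m).piecewise
      (fun _ => EuclideanSpace.single 0 1) fun _ => EuclideanSpace.single 1 1 := by
    ext1 i
    simp [e, Finset.piecewise]
  have hmom' : ∀ i j : ℕ, i + j < N →
      ∑ q, (x q - xp) 0 ^ i * (x q - xp) 1 ^ j * w q =
        if i = m ∧ j = n then ((m.factorial : ℝ) * (n.factorial : ℝ)) else 0 := by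
    simpa using hmom
  have hP : ∑ q, w q * P q = iteratedFDerivWithin ℝ (m + n) f B xp e := by
    have hterm : ∀ l : ℕ, ∑ q, w q * ((l.factorial : ℝ)⁻¹ *
        iteratedFDerivWithin ℝ l f B xp fun _ => x q - xp) = (l.factorial : ℝ)⁻¹ *
        ∑ q, w q * iteratedFDerivWithin ℝ l f B xp fun _ => x q - xp := by
      intro l
      rw [mul_sum]
      exact sum_congr rfl fun q _ => by ring
    simp_rw [P, mul_sum]
    rw [sum_comm, sum_eq_single_of_mem (m + n) (mem_range.2 hN)]
    · rw [hterm, sum_weight_mul_apply_const_add hmom' hN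
        (c := iteratedFDerivWithin ℝ (m + n) f B xp e), inv_mul_cancel_left₀ (by positivity)]
      intro s hs
      rw [hD, he]
      exact hfxp.iteratedFDeriv_piecewise_eq_of_card_eq _ _ (by simp [hs, Fin.card_filter_val_lt])
    · intro l hl hne
      rw [hterm, sum_weight_mul_apply_const_of_ne hmom' (mem_range.1 hl) hne, mul_zero]
  calc |∑ q, w q * f (x q) - iteratedFDerivWithin ℝ (m + n) f B xp e|
      = |∑ q, w q * (f (x q) - P q)| := by rw [← hP, ← sum_sub_distrib]; simp_rw [mul_sub]
    _ ≤ ∑ q, |w q * (f (x q) - P q)| := abs_sum_le_sum_abs _ _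
    _ ≤ ∑ q, |w q| * (δ ^ N / N.factorial * M) := by
        gcongr with q
        rw [abs_mul]
        gcongr
        exact hrem q
    _ = (∑ q, |w q|) * (δ ^ N / N.factorial) * M := by rw [← sum_mul, mul_assoc]
end

section
/- Let x_p ∈ ℝ², ε > 0, and let z_1,…,z_k ∈ ℝ² be the offsets z_q = x_q − x_p of k neighbor points. Let m, n ≥ 0 and N > m + n be integers, let p_1,…,p_l enumerate the monomials x^i y^j with i + j < N, let e_1,…,e_k be nonzero reals, let V be the k × l matrix with entries V_{q,i} = p_i(z_q/ε), let E = diag(e_1,…,e_k), and let b ∈ ℝ^l have entries b_i = (∂^{m+n} p_i / ∂x^m ∂y^n)(0). Suppose A := (EV)ᵀ(EV) is invertible and let a = A^{-1} b. Define the weights w_q = ε^{−(m+n)} · (Σ_{j=1}^{l} a_j p_j(z_q/ε)) · e_q². Then for every polynomial f : ℝ² → ℝ of total degree strictly less than N, Σ_{q=1}^{k} w_q f(x_q) = (∂^{m+n} f / ∂x^m ∂y^n)(x_p); that is, the DC PSE operator constructed from the solution of the normal equations satisfies the moment conditions exactly and reproduces the derivative D^{m,n} on all polynomials of degree < N. 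-/
open MvPolynomial Finset Matrix

namespace MvPolynomial

variable {σ R M : Type*}

/-- Linear maps that agree on the monomials of degree less than `N` agree on all polynomials of
total degree less than `N`. -/
theorem linearMap_eq_of_totalDegree_lt [CommSemiring R] [AddCommMonoid M] [Module R M]
    {N : ℕ} {L L' : MvPolynomial σ R →ₗ[R] M}
    (h : ∀ s : σ →₀ ℕ, (s.sum fun _ i => i) < N → L (monomial s 1) = L' (monomial s 1))
    {f : MvPolynomial σ R} (hf : f.totalDegree < N) : L f = L' f := by
  rw [f.as_sum, map_sum, map_sum]
  refine Finset.sum_congr rfl fun s hs => ?_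
  have key : monomial s (coeff s f) = coeff s f • monomial s (1 : R) := by
    rw [smul_monomial, smul_eq_mul, mul_one]
  rw [key, map_smul, map_smul, h s ((le_totalDegree hs).trans_lt hf)]

/-- Substituting polynomials of total degree at most one does not increase the total degree. -/
theorem totalDegree_aeval_le_of_totalDegree_le_one {τ : Type*} [CommSemiring R]
    {g : σ → MvPolynomial τ R} (hg : ∀ i, (g i).totalDegree ≤ 1) (f : MvPolynomial σ R) :
    (aeval g f).totalDegree ≤ f.totalDegree := by
  rw [aeval_def, eval₂_eq]
  refine totalDegree_finsetSum_le fun s hs => ?_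
  refine (totalDegree_mul _ _).trans ?_
  rw [algebraMap_eq, totalDegree_C, zero_add]
  refine (totalDegree_finsetProd _ _).trans (le_trans ?_ (le_totalDegree hs))
  refine Finset.sum_le_sum fun i _ => (totalDegree_pow _ _).trans ?_
  exact (Nat.mul_le_mul_left _ (hg i)).trans_eq (mul_one _)

/-- The chain rule for the affine substitution `X i ↦ c i + r * X i`. -/
theorem pderiv_aeval_affine [CommSemiring R] (c : σ → R) (r : R) (i : σ) (f : MvPolynomial σ R) :
    pderiv i (aeval (fun j => C (c j) + C r * X j) f) =
      r • aeval (fun j => C (c j) + C r * X j) (pderiv i f) := by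
  classical
  induction f using MvPolynomial.induction_on with
  | C a => simp [algebraMap_eq]
  | add f g hf hg => simp only [map_add, hf, hg, smul_add]
  | mul_X f j hf =>
    simp only [map_mul, map_add, aeval_X, Derivation.leibniz, hf, smul_eq_mul, pderiv_C,
      pderiv_X, smul_eq_C_mul, Pi.single_apply]
    split_ifs <;> simp <;> ring

theorem iterate_pderiv_aeval_affine [CommSemiring R] (c : σ → R) (r : R) (i : σ) (k : ℕ)
    (f : MvPolynomial σ R) :
    (⇑(pderiv i))^[k] (aeval (fun j => C (c j) + C r * X j) f) =
      r ^ k • aeval (fun j => C (c j) + C r * X j) ((⇑(pderiv i))^[k] f) := by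
  induction k with
  | zero => simp
  | succ k ih =>
    rw [Function.iterate_succ_apply', Function.iterate_succ_apply', ih, Derivation.map_smul,
      pderiv_aeval_affine, smul_smul, pow_succ]

end MvPolynomial

/-- A weighted Gram system `(EV)ᵀ(EV) a = b`, written out entrywise. -/
theorem Matrix.sum_gram_inv_mulVec {k l R : Type*} [Fintype k] [Fintype l] [DecidableEq k]
    [DecidableEq l] [CommRing R] (e : k → R) (V : Matrix k l R)
    (hA : IsUnit ((diagonal e * V)ᵀ * (diagonal e * V))) (b : l → R) (t : l) :
    ∑ q, (∑ j, (((diagonal e * V)ᵀ * (diagonal e * V))⁻¹ *ᵥ b) j * V q j) * e q ^ 2 * V q t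
      = b t := by
  set A := (diagonal e * V)ᵀ * (diagonal e * V) with hA'
  have h : (A *ᵥ (A⁻¹ *ᵥ b)) t = b t := by
    rw [mulVec_mulVec, mul_nonsing_inv _ ((isUnit_iff_isUnit_det A).1 hA), one_mulVec]
  rw [← h]
  generalize A⁻¹ *ᵥ b = a
  simp only [hA', mulVec, dotProduct, mul_apply (M := (diagonal e * V)ᵀ), transpose_apply,
    diagonal_mul, Finset.sum_mul]
  rw [Finset.sum_comm]
  refine Finset.sum_congr rfl fun j _ => Finset.sum_congr rfl fun q _ => ?_
  ring

/-- **The DC PSE operator built from the normal equations reproduces `D^{m,n}`.**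
The monomials `x^i y^j` with `i + j < N` are enumerated by `d : Fin l`, the
Vandermonde matrix `V` evaluates them at the scaled offsets `z q / ε`,
`E = diag e` with nonzero window values `e q`, and
`b` is the vector of derivatives `D^{m,n}` of the basis monomials at `0`.
If `A = (EV)ᵀ(EV)` is invertible and `a = A⁻¹ b`, then the weights
`w q = ε^{-(m+n)} (∑ j, a j · p_j(z_q/ε)) · e_q²` reproduce the derivative
`∂^{m+n} f / ∂x^m ∂y^n (x_p)` exactly on all polynomials `f` of total degree `< N`. -/
theorem dcpse_normal_equations_reproduce
    (k l m n N : ℕ) (hN : m + n < N)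
    (d : Fin l ≃ {ij : ℕ × ℕ // ij.1 + ij.2 < N})
    (ε : ℝ) (hε : 0 < ε)
    (xp : ℝ × ℝ) (z : Fin k → ℝ × ℝ)
    (e : Fin k → ℝ) (he : ∀ q, e q ≠ 0)
    (p : Fin l → MvPolynomial (Fin 2) ℝ)
    (hp : ∀ t, p t =
      monomial (Finsupp.single (0 : Fin 2) (d t).1.1 + Finsupp.single (1 : Fin 2) (d t).1.2) (1 : ℝ))
    (V : Matrix (Fin k) (Fin l) ℝ)
    (hV : ∀ q t, V q t = eval ![(z q).1 / ε, (z q).2 / ε] (p t))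
    (E : Matrix (Fin k) (Fin k) ℝ) (hE : E = Matrix.diagonal e)
    (b : Fin l → ℝ)
    (hb : ∀ t, b t = eval (fun _ => (0 : ℝ))
      ((⇑(pderiv (0 : Fin 2)))^[m] ((⇑(pderiv (1 : Fin 2)))^[n] (p t))))
    (hA : IsUnit ((E * V)ᵀ * (E * V)))
    (a : Fin l → ℝ) (ha : a = ((E * V)ᵀ * (E * V))⁻¹.mulVec b)
    (w : Fin k → ℝ)
    (hw : ∀ q, w q = (ε ^ (m + n))⁻¹ *
      (∑ j, a j * eval ![(z q).1 / ε, (z q).2 / ε] (p j)) * (e q) ^ 2)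
    (f : MvPolynomial (Fin 2) ℝ) (hf : f.totalDegree < N) :
    ∑ q, w q * eval ![xp.1 + (z q).1, xp.2 + (z q).2] f =
      eval ![xp.1, xp.2]
        ((⇑(pderiv (0 : Fin 2)))^[m] ((⇑(pderiv (1 : Fin 2)))^[n] f)) := by
  subst hE ha
  have moments (t : Fin l) := Matrix.sum_gram_inv_mulVec e V hA b t
  set a := ((Matrix.diagonal e * V)ᵀ * (Matrix.diagonal e * V))⁻¹ *ᵥ b
  let u : Fin k → Fin 2 → ℝ := fun q => ![(z q).1 / ε, (z q).2 / ε]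
  let L : MvPolynomial (Fin 2) ℝ →ₗ[ℝ] ℝ :=
    ∑ q, ((∑ j, a j * V q j) * e q ^ 2) • (aeval (u q)).toLinearMap
  let P : Fin 2 → Module.End ℝ (MvPolynomial (Fin 2) ℝ) := fun i => (pderiv (R := ℝ) i).toLinearMap
  let D : MvPolynomial (Fin 2) ℝ →ₗ[ℝ] ℝ :=
    (aeval fun _ => (0 : ℝ)).toLinearMap ∘ₗ
      (P 0 ^ m * P 1 ^ n)
  have hL (g : MvPolynomial (Fin 2) ℝ) :
      L g = ∑ q, (∑ j, a j * V q j) * e q ^ 2 * eval (u q) g := by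
    simp [L, aeval_eq_eval]
  have hD (g : MvPolynomial (Fin 2) ℝ) :
      D g = eval (fun _ => (0 : ℝ))
        ((⇑(pderiv (0 : Fin 2)))^[m] ((⇑(pderiv (1 : Fin 2)))^[n] g)) := by
    simp [D, P, aeval_eq_eval, Module.End.pow_apply]
  have hLD {g : MvPolynomial (Fin 2) ℝ} (hg : g.totalDegree < N) : L g = D g := by
    refine linearMap_eq_of_totalDegree_lt (fun s hs => ?_) hg
    have hs' : s 0 + s 1 < N := by
      rwa [Finsupp.sum_fintype _ _ fun _ => rfl, Fin.sum_univ_two] at hs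
    have hps : monomial s 1 = p (d.symm ⟨(s 0, s 1), hs'⟩) := by
      rw [hp, Equiv.apply_symm_apply]
      have hs_eq : s = Finsupp.single 0 (s 0) + Finsupp.single 1 (s 1) := by
        ext i
        fin_cases i <;> simp
      exact congrArg (fun s => monomial s 1) hs_eq
    rw [hps, hL, hD, ← hb, ← moments]
    simp only [hV, u]
  let c : Fin 2 → ℝ := ![xp.1, xp.2]
  let φ : Fin 2 → MvPolynomial (Fin 2) ℝ := fun j => C (c j) + C ε * X j
  have hφ (j : Fin 2) : (φ j).totalDegree ≤ 1 := by
    refine (totalDegree_add (C (c j)) (C ε * X j)).trans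
      (max_le (by simp) ((totalDegree_mul (C ε) (X j)).trans ?_))
    simp
  have eval_φ (v : Fin 2 → ℝ) (g : MvPolynomial (Fin 2) ℝ) :
      eval v (aeval φ g) = eval (fun j => c j + ε * v j) g := by
    induction g using MvPolynomial.induction_on with
    | C r => simp [algebraMap_eq]
    | add g g' hg hg' => simp only [map_add, hg, hg']
    | mul_X g j hg => simp only [map_mul, aeval_X, hg, φ]; simp
  have h := hLD ((totalDegree_aeval_le_of_totalDegree_le_one hφ f).trans_lt hf)
  have smul_iter (r : ℝ) (g : MvPolynomial (Fin 2) ℝ) :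
      (⇑(pderiv (0 : Fin 2)))^[m] (r • g) = r • (⇑(pderiv (0 : Fin 2)))^[m] g :=
    Function.Commute.iterate_left (fun g => Derivation.map_smul _ r g) m g
  rw [hL, hD, iterate_pderiv_aeval_affine, smul_iter, iterate_pderiv_aeval_affine, smul_smul,
    ← pow_add, add_comm n m, smul_eval, eval_φ] at h
  have hz (q : Fin k) : ![xp.1 + (z q).1, xp.2 + (z q).2] = fun j => c j + ε * u q j := by
    ext j
    fin_cases j <;> simp [c, u, mul_div_cancel₀ _ hε.ne']
  have hc : (fun j => c j + ε * 0) = ![xp.1, xp.2] := by simp [c]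
  rw [hc] at h
  rw [← mul_right_inj' (pow_ne_zero (m + n) hε.ne'), ← h, Finset.mul_sum]
  refine Finset.sum_congr rfl fun q _ => ?_
  simp only [eval_φ, hw, hz, hV, u]
  field_simp
end

section
/- Let σ0 ∈ ℝ and a > 0, and let σ_xx, σ_yy, σ_xy be the Kirsch stress field. Then the boundary of the hole is traction free: for every angle θ, at the point r = a one has σ_xx(a,θ)·cos θ + σ_xy(a,θ)·sin θ = 0 and σ_xy(a,θ)·cos θ + σ_yy(a,θ)·sin θ = 0; that is, σ·n = 0 on the circle r = a, where n = (cos θ, sin θ) is the unit normal. -/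
open Real

/-- Kirsch stress component `σ_xx` in polar coordinates `(r, θ)`. -/
noncomputable def kirschSxx (σ0 a r θ : ℝ) : ℝ :=
  σ0 * (1 - a ^ 2 / r ^ 2 * ((3 / 2) * Real.cos (2 * θ) + Real.cos (4 * θ)) +
    3 * a ^ 4 / (2 * r ^ 4) * Real.cos (4 * θ))

/-- Kirsch stress component `σ_yy` in polar coordinates `(r, θ)`. -/
noncomputable def kirschSyy (σ0 a r θ : ℝ) : ℝ :=
  σ0 * (-(a ^ 2 / r ^ 2) * ((1 / 2) * Real.cos (2 * θ) - Real.cos (4 * θ)) -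
    3 * a ^ 4 / (2 * r ^ 4) * Real.cos (4 * θ))

/-- Kirsch stress component `σ_xy` in polar coordinates `(r, θ)`. -/
noncomputable def kirschSxy (σ0 a r θ : ℝ) : ℝ :=
  σ0 * (-(a ^ 2 / r ^ 2) * ((1 / 2) * Real.sin (2 * θ) + Real.sin (4 * θ)) +
    3 * a ^ 4 / (2 * r ^ 4) * Real.sin (4 * θ))

/-- **The hole boundary of the Kirsch solution is traction free:**
for every angle `θ`, at `r = a` one has `σ·n = 0` where `n = (cos θ, sin θ)`. -/
theorem kirsch_hole_traction_free (σ0 a : ℝ) (ha : 0 < a) (θ : ℝ) :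
    kirschSxx σ0 a a θ * Real.cos θ + kirschSxy σ0 a a θ * Real.sin θ = 0 ∧
    kirschSxy σ0 a a θ * Real.cos θ + kirschSyy σ0 a a θ * Real.sin θ = 0 := by
  have h2 : a ^ 2 / a ^ 2 = 1 := div_self (by positivity)
  have h4 : 3 * a ^ 4 / (2 * a ^ 4) = 3 / 2 :=
    mul_div_mul_right _ _ (by positivity)
  have hc : Real.cos (4 * θ) = 2 * Real.cos (2 * θ) ^ 2 - 1 := by
    rw [← Real.cos_two_mul]; ring_nf
  have hs : Real.sin (4 * θ) = 2 * Real.sin (2 * θ) * Real.cos (2 * θ) := by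
    rw [← Real.sin_two_mul]; ring_nf
  simp only [kirschSxx, kirschSyy, kirschSxy, h2, h4, hc, hs, Real.cos_two_mul, Real.sin_two_mul]
  constructor
  · linear_combination σ0 * Real.cos θ * (4 * Real.cos θ ^ 2 - 3) * Real.sin_sq_add_cos_sq θ
  · ring
end

section
/- Let σ0 > 0 and a > 0, and let σ_xx, σ_yy, σ_xy be the Kirsch stress field. Define the tangential (hoop) normal stress along the hole boundary by σ_tt(θ) = σ_xx(a,θ)·sin²θ − 2σ_xy(a,θ)·sin θ·cos θ + σ_yy(a,θ)·cos²θ. Then for every θ, σ_tt(θ) = σ0(1 − 2cos 2θ); consequently the maximum of σ_tt over all θ equals 3σ0, attained at θ = ±π/2, so the stress concentration factor at the hole is 3. -/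
open Real

/-- Tangential (hoop) normal stress of the Kirsch field along the hole boundary. -/
noncomputable def kirschHoop (σ0 a θ : ℝ) : ℝ :=
  kirschSxx σ0 a a θ * Real.sin θ ^ 2 -
    2 * kirschSxy σ0 a a θ * Real.sin θ * Real.cos θ +
    kirschSyy σ0 a a θ * Real.cos θ ^ 2

/-- The hoop stress on the boundary of the hole is `σ0 (1 - 2 cos 2θ)`. -/
theorem kirschHoop_eq (σ0 : ℝ) {a : ℝ} (ha : a ≠ 0) (θ : ℝ) :
    kirschHoop σ0 a θ = σ0 * (1 - 2 * Real.cos (2 * θ)) := by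
  have h2 : a ^ 2 / a ^ 2 = 1 := div_self (pow_ne_zero 2 ha)
  have h4 : 3 * a ^ 4 / (2 * a ^ 4) = 3 / 2 := mul_div_mul_right 3 2 (pow_ne_zero 4 ha)
  have hc : Real.cos (4 * θ) = 2 * Real.cos (2 * θ) ^ 2 - 1 := by
    rw [← Real.cos_two_mul]; ring_nf
  have hs : Real.sin (4 * θ) = 2 * Real.sin (2 * θ) * Real.cos (2 * θ) := by
    rw [← Real.sin_two_mul]; ring_nf
  have hcos_sq : Real.cos θ ^ 2 = 1 - Real.sin θ ^ 2 := Real.cos_sq' θ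
  have hcos_two : Real.cos (2 * θ) = 1 - 2 * Real.sin θ ^ 2 := by
    rw [Real.cos_two_mul, hcos_sq]; ring
  simp only [kirschHoop, kirschSxx, kirschSyy, kirschSxy, h2, h4, hc, hs,
    Real.sin_two_mul, hcos_two]
  ring_nf
  simp only [hcos_sq]
  ring

/-- **Hoop stress and stress concentration factor 3.**
For every `θ`, `σ_tt(θ) = σ0 (1 − 2 cos 2θ)`; the maximum of `σ_tt` over all `θ`
equals `3 σ0`, attained at `θ = ±π/2`. -/
theorem kirsch_hoop_stress_concentration (σ0 a : ℝ) (hσ0 : 0 < σ0) (ha : 0 < a) :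
    (∀ θ : ℝ, kirschHoop σ0 a θ = σ0 * (1 - 2 * Real.cos (2 * θ))) ∧
    (∀ θ : ℝ, kirschHoop σ0 a θ ≤ 3 * σ0) ∧
    kirschHoop σ0 a (π / 2) = 3 * σ0 ∧
    kirschHoop σ0 a (-(π / 2)) = 3 * σ0 := by
  have hoop := kirschHoop_eq σ0 ha.ne'
  refine ⟨hoop, fun θ => ?_, ?_, ?_⟩
  · rw [hoop]
    nlinarith [Real.neg_one_le_cos (2 * θ)]
  · rw [hoop, mul_div_cancel₀ π two_ne_zero, Real.cos_pi]
    ring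
  · rw [hoop, mul_neg, Real.cos_neg, mul_div_cancel₀ π two_ne_zero, Real.cos_pi]
    ring
end

section
/- Let F ∈ ℝ, a > 0, b > 0, 0 < ν < 1, I = 4ab³/3, and let σ_zz, σ_xz, σ_yz be the cantilever beam stress field. Then the stress field is in static equilibrium with zero body force on the open beam (−a,a) × (−b,b) × ℝ: at every interior point, ∂σ_xz/∂x + ∂σ_yz/∂y + ∂σ_zz/∂z = 0 (and since σ_xx = σ_yy = σ_xy = 0 and σ_xz, σ_yz are independent of z, the remaining two equilibrium equations ∂σ_xz/∂z = 0 and ∂σ_yz/∂z = 0 hold as well, so div σ = 0). -/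
open Real

/-- Cantilever beam shear stress `σ_xz` (series solution); `II = 4ab³/3`. -/
noncomputable def beamSxz (F II a b ν x y : ℝ) : ℝ :=
  F / II * (2 * a ^ 2 / π ^ 2) * (ν / (1 + ν)) *
    ∑' m : ℕ, ((-1 : ℝ) ^ (m + 1) / ((m : ℝ) + 1) ^ 2) *
      Real.sin (((m : ℝ) + 1) * π * x / a) *
      Real.sinh (((m : ℝ) + 1) * π * y / a) / Real.cosh (((m : ℝ) + 1) * π * b / a)

/-- Cantilever beam shear stress `σ_yz` (series solution); `II = 4ab³/3`. -/
noncomputable def beamSyz (F II a b ν x y : ℝ) : ℝ :=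
  F / II * ((b ^ 2 - y ^ 2) / 2) +
    F / II * (ν / (1 + ν)) *
      ((3 * x ^ 2 - a ^ 2) / 6 -
        (2 * a ^ 2 / π ^ 2) *
          ∑' m : ℕ, ((-1 : ℝ) ^ (m + 1) / ((m : ℝ) + 1) ^ 2) *
            Real.cos (((m : ℝ) + 1) * π * x / a) *
            Real.cosh (((m : ℝ) + 1) * π * y / a) / Real.cosh (((m : ℝ) + 1) * π * b / a))

/-- Cantilever beam axial stress `σ_zz = (F/I)·y·z`. -/
noncomputable def beamSzz (F II y z : ℝ) : ℝ := F / II * y * z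

lemma beam_abs_sinh_le_cosh (t : ℝ) : |Real.sinh t| ≤ Real.cosh t := by
  rw [← Real.cosh_abs t, Real.abs_sinh]
  exact (Real.sinh_lt_cosh _).le

lemma beam_cosh_div_cosh_le {s B : ℝ} : Real.cosh s / Real.cosh B ≤ 2 * Real.exp (|s| - B) := by
  rw [div_le_iff₀ (Real.cosh_pos B)]
  have h1 : Real.cosh s ≤ Real.exp |s| := by
    rw [← Real.cosh_abs s, Real.cosh_eq]
    have : Real.exp (-|s|) ≤ Real.exp |s| := Real.exp_le_exp.2 (by linarith [abs_nonneg s])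
    linarith
  have h2 : Real.exp B ≤ 2 * Real.cosh B := by
    rw [Real.cosh_eq]
    linarith [Real.exp_pos (-B)]
  have h3 : Real.exp (|s| - B) * Real.exp B = Real.exp |s| := by
    rw [← Real.exp_add]
    congr 1
    ring
  nlinarith [Real.exp_pos (|s| - B)]

/-- Geometric bound for the hyperbolic factors of the beam series, uniform in `|t| ≤ r`. -/
lemma beam_cosh_ratio_le {a b r t : ℝ} (ha : 0 < a) (ht : |t| ≤ r) (m : ℕ) :
    Real.cosh (((m : ℝ) + 1) * π * t / a) / Real.cosh (((m : ℝ) + 1) * π * b / a) ≤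
      2 * Real.exp (-(π * (b - r) / a)) ^ (m + 1) := by
  refine beam_cosh_div_cosh_le.trans ?_
  rw [← Real.exp_nat_mul]
  have hk : 0 ≤ ((m : ℝ) + 1) * π / a := by positivity
  have habs : |((m : ℝ) + 1) * π * t / a| = ((m : ℝ) + 1) * π / a * |t| := by
    rw [mul_div_right_comm, abs_mul, abs_of_nonneg hk]
  gcongr
  rw [habs]
  calc ((m : ℝ) + 1) * π / a * |t| - ((m : ℝ) + 1) * π * b / a
      ≤ ((m : ℝ) + 1) * π / a * r - ((m : ℝ) + 1) * π * b / a := by gcongr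
    _ = _ := by push_cast; ring

lemma beam_summable_geometric {a b r : ℝ} (ha : 0 < a) (hr : r < b) (C : ℝ) :
    Summable fun m : ℕ => C * (2 * Real.exp (-(π * (b - r) / a)) ^ (m + 1)) := by
  have hq : Real.exp (-(π * (b - r) / a)) < 1 := by
    rw [Real.exp_lt_one_iff, neg_lt_zero]
    have := sub_pos.2 hr
    positivity
  exact (((summable_nat_add_iff 1).2
    (summable_geometric_of_lt_one (Real.exp_pos _).le hq)).mul_left 2).mul_left C

/-- The common termwise derivative of the two series: `∂/∂x` of the `sin · sinh` term and
`∂/∂y` of the `cos · cosh` term. -/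
noncomputable def beamDerivTerm (a b x y : ℝ) (m : ℕ) : ℝ :=
  ((-1 : ℝ) ^ (m + 1) / ((m : ℝ) + 1) ^ 2) * (((m : ℝ) + 1) * π / a) *
    Real.cos (((m : ℝ) + 1) * π * x / a) *
    Real.sinh (((m : ℝ) + 1) * π * y / a) / Real.cosh (((m : ℝ) + 1) * π * b / a)

lemma norm_beamDerivTerm_le {a b r y : ℝ} (ha : 0 < a) (hy : |y| ≤ r) (x : ℝ) (m : ℕ) :
    ‖beamDerivTerm a b x y m‖ ≤ π / a * (2 * Real.exp (-(π * (b - r) / a)) ^ (m + 1)) := by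
  have hm : (0 : ℝ) < (m : ℝ) + 1 := by positivity
  have hcoef : |(-1 : ℝ) ^ (m + 1) / ((m : ℝ) + 1) ^ 2 * (((m : ℝ) + 1) * π / a)| ≤ π / a := by
    have h : |(-1 : ℝ) ^ (m + 1) / ((m : ℝ) + 1) ^ 2 * (((m : ℝ) + 1) * π / a)| =
        π / a / ((m : ℝ) + 1) := by
      rw [abs_mul, abs_div, abs_pow, abs_neg, abs_one, one_pow,
        abs_of_pos (by positivity : (0 : ℝ) < ((m : ℝ) + 1) ^ 2),
        abs_of_pos (by positivity : (0 : ℝ) < ((m : ℝ) + 1) * π / a)]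
      field_simp
    rw [h]
    exact div_le_self (by positivity) (by linarith [(Nat.cast_nonneg m : (0 : ℝ) ≤ m)])
  have hratio : |Real.sinh (((m : ℝ) + 1) * π * y / a) / Real.cosh (((m : ℝ) + 1) * π * b / a)| ≤
      2 * Real.exp (-(π * (b - r) / a)) ^ (m + 1) := by
    rw [abs_div, abs_of_pos (Real.cosh_pos (((m : ℝ) + 1) * π * b / a))]
    exact (div_le_div_of_nonneg_right (beam_abs_sinh_le_cosh _) (Real.cosh_pos _).le).trans
      (beam_cosh_ratio_le ha hy m)
  rw [beamDerivTerm, mul_div_assoc, Real.norm_eq_abs, abs_mul, abs_mul]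
  refine mul_le_mul ?_ hratio (abs_nonneg _) (by positivity)
  exact (mul_le_of_le_one_right (abs_nonneg _) (Real.abs_cos_le_one _)).trans hcoef

lemma hasDerivAt_beam_angle (a t : ℝ) (m : ℕ) :
    HasDerivAt (fun s : ℝ => ((m : ℝ) + 1) * π * s / a) (((m : ℝ) + 1) * π / a) t := by
  simpa using ((hasDerivAt_id t).const_mul (((m : ℝ) + 1) * π)).div_const a

lemma hasDerivAt_beam_sin_series {a b y : ℝ} (ha : 0 < a) (hy : |y| < b) (x : ℝ) :
    HasDerivAt (fun s => ∑' m : ℕ, ((-1 : ℝ) ^ (m + 1) / ((m : ℝ) + 1) ^ 2) *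
      Real.sin (((m : ℝ) + 1) * π * s / a) *
      Real.sinh (((m : ℝ) + 1) * π * y / a) / Real.cosh (((m : ℝ) + 1) * π * b / a))
      (∑' m, beamDerivTerm a b x y m) x := by
  refine hasDerivAt_tsum_of_isPreconnected (beam_summable_geometric ha hy (π / a)) isOpen_univ
    isPreconnected_univ (g' := fun m s => beamDerivTerm a b s y m) (y₀ := 0) (fun m s _ => ?_)
    (fun m s _ => norm_beamDerivTerm_le ha le_rfl s m) (Set.mem_univ _) (by simp)
    (Set.mem_univ _)
  refine HasDerivAt.congr_deriv ((((hasDerivAt_beam_angle a s m).sin.const_mul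
    ((-1 : ℝ) ^ (m + 1) / ((m : ℝ) + 1) ^ 2)).mul_const
    (Real.sinh (((m : ℝ) + 1) * π * y / a))).div_const
    (Real.cosh (((m : ℝ) + 1) * π * b / a))) ?_
  simp only [beamDerivTerm]
  ring

lemma hasDerivAt_beam_cosh_series {a b y : ℝ} (ha : 0 < a) (hy : |y| < b) (x : ℝ) :
    HasDerivAt (fun t => ∑' m : ℕ, ((-1 : ℝ) ^ (m + 1) / ((m : ℝ) + 1) ^ 2) *
      Real.cos (((m : ℝ) + 1) * π * x / a) *
      Real.cosh (((m : ℝ) + 1) * π * t / a) / Real.cosh (((m : ℝ) + 1) * π * b / a))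
      (∑' m, beamDerivTerm a b x y m) y := by
  obtain ⟨r, hyr, hrb⟩ := exists_between hy
  have hr : 0 < r := (abs_nonneg y).trans_lt hyr
  refine hasDerivAt_tsum_of_isPreconnected (beam_summable_geometric ha hrb (π / a)) isOpen_Ioo
    isPreconnected_Ioo (t := Set.Ioo (-r) r) (g' := fun m t => beamDerivTerm a b x t m)
    (y₀ := 0) (fun m t _ => ?_)
    (fun m t ht => norm_beamDerivTerm_le ha (abs_lt.2 ht).le x m) ⟨by linarith, hr⟩ ?_
    (abs_lt.1 hyr)
  · refine HasDerivAt.congr_deriv (((hasDerivAt_beam_angle a t m).cosh.const_mul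
      ((-1 : ℝ) ^ (m + 1) / ((m : ℝ) + 1) ^ 2 * Real.cos (((m : ℝ) + 1) * π * x / a))).div_const
      (Real.cosh (((m : ℝ) + 1) * π * b / a))) ?_
    simp only [beamDerivTerm]
    ring
  · refine Summable.of_norm_bounded (beam_summable_geometric ha hrb 1) fun m => ?_
    have hcoef : |(-1 : ℝ) ^ (m + 1) / ((m : ℝ) + 1) ^ 2| ≤ 1 := by
      rw [abs_div, abs_pow, abs_neg, abs_one, one_pow,
        abs_of_pos (by positivity : (0 : ℝ) < ((m : ℝ) + 1) ^ 2)]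
      exact div_le_self zero_le_one
        (one_le_pow₀ (by linarith [(Nat.cast_nonneg m : (0 : ℝ) ≤ m)]))
    rw [mul_div_assoc, Real.norm_eq_abs, abs_mul, abs_mul]
    refine mul_le_mul (mul_le_one₀ hcoef (abs_nonneg _) (Real.abs_cos_le_one _)) ?_
      (abs_nonneg _) zero_le_one
    rw [abs_of_pos (div_pos (Real.cosh_pos _) (Real.cosh_pos _))]
    exact beam_cosh_ratio_le ha (by simpa using hr.le) m

/-- **The cantilever beam stress field is in static equilibrium with zero body
force** on the open beam `(−a,a) × (−b,b) × ℝ`: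
`∂σ_xz/∂x + ∂σ_yz/∂y + ∂σ_zz/∂z = 0` (the partial derivatives exist), and since
`σ_xx = σ_yy = σ_xy = 0` and `σ_xz, σ_yz` do not depend on `z`, the remaining
two equilibrium equations `∂σ_xz/∂z = 0` and `∂σ_yz/∂z = 0` hold as well. -/
theorem beam_equilibrium (F a b ν II : ℝ) (ha : 0 < a) (hb : 0 < b)
    (hν₁ : 0 < ν) (hν₂ : ν < 1) (hII : II = 4 * a * b ^ 3 / 3)
    (x y z : ℝ) (hx : x ∈ Set.Ioo (-a) a) (hy : y ∈ Set.Ioo (-b) b) :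
    DifferentiableAt ℝ (fun s => beamSxz F II a b ν s y) x ∧
    DifferentiableAt ℝ (fun t => beamSyz F II a b ν x t) y ∧
    deriv (fun s => beamSxz F II a b ν s y) x +
        deriv (fun t => beamSyz F II a b ν x t) y +
        deriv (fun u => beamSzz F II y u) z = 0 ∧
    deriv (fun u => beamSxz F II a b ν x y) z = 0 ∧
    deriv (fun u => beamSyz F II a b ν x y) z = 0 := by
  have hyb : |y| < b := abs_lt.2 hy
  have h1 : HasDerivAt (fun s => beamSxz F II a b ν s y) _ x :=
    (hasDerivAt_beam_sin_series ha hyb x).const_mul (F / II * (2 * a ^ 2 / π ^ 2) * (ν / (1 + ν)))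
  have h2 : HasDerivAt (fun t => beamSyz F II a b ν x t) _ y :=
    ((((hasDerivAt_pow 2 y).const_sub (b ^ 2)).div_const 2).const_mul (F / II)).add
      ((((hasDerivAt_beam_cosh_series ha hyb x).const_mul (2 * a ^ 2 / π ^ 2)).const_sub
        ((3 * x ^ 2 - a ^ 2) / 6)).const_mul (F / II * (ν / (1 + ν))))
  have h3 : HasDerivAt (fun u => beamSzz F II y u) (F / II * y * 1) z :=
    (hasDerivAt_id z).const_mul (F / II * y)
  refine ⟨h1.differentiableAt, h2.differentiableAt, ?_, deriv_const _ _, deriv_const _ _⟩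
  rw [h1.deriv, h2.deriv, h3.deriv]
  norm_num
  ring
end

section
/- Let F ∈ ℝ, a > 0, b > 0, 0 < ν < 1, I = 4ab³/3, and let σ_zz, σ_xz, σ_yz be the cantilever beam stress field. Then the lateral surfaces of the beam are traction free: for every y ∈ [−b, b], σ_xz(a, y) = σ_xz(−a, y) = 0, and for every x ∈ [−a, a], σ_yz(x, b) = σ_yz(x, −b) = 0. (Together with σ_xx = σ_yy = σ_xy = 0 this shows σ·n = 0 on all four lateral faces.) -/
open Real

/-- The cosine series of the second Bernoulli polynomial, recentred at the midpoint of its period. -/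
lemma hasSum_neg_one_pow_div_sq_mul_cos {a x : ℝ} (ha : 0 < a) (hx : x ∈ Set.Icc (-a) a) :
    HasSum (fun m : ℕ => ((-1 : ℝ) ^ (m + 1) / ((m : ℝ) + 1) ^ 2) *
      Real.cos (((m : ℝ) + 1) * π * x / a))
      (π ^ 2 * (x ^ 2 / (4 * a ^ 2) - 1 / 12)) := by
  have ht : (x + a) / (2 * a) ∈ Set.Icc (0 : ℝ) 1 :=
    ⟨div_nonneg (by linarith [hx.1]) (by positivity),
      (div_le_one (by positivity)).2 (by linarith [hx.2])⟩
  have h := (hasSum_nat_add_iff' 1).2 (hasSum_one_div_nat_pow_mul_cos one_ne_zero ht)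
  convert! h using 1
  · ext m
    have harg : 2 * π * ((m + 1 : ℕ) : ℝ) * ((x + a) / (2 * a)) =
        ((m : ℝ) + 1) * π * x / a + ((m + 1 : ℕ) : ℝ) * π := by
      push_cast
      field_simp
    rw [harg, Real.cos_add_nat_mul_pi]
    push_cast
    ring
  · have hB : Polynomial.bernoulli 2 =
        Polynomial.X ^ 2 - Polynomial.X + Polynomial.C (1 / 6 : ℚ) := by
      simp [Polynomial.bernoulli, Finset.sum_range_succ, bernoulli_two, bernoulli_one,
        ← Polynomial.C_mul_X_pow_eq_monomial]
      have hC : Polynomial.C (-1 / 2 : ℚ) * 2 = -1 := by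
        rw [← Polynomial.C_ofNat, ← Polynomial.C_mul]
        norm_num
      linear_combination Polynomial.X * hC
    simp [hB]
    field_simp
    ring

lemma sin_natCast_add_one_mul_pi_mul_div_self {a : ℝ} (ha : a ≠ 0) (m : ℕ) :
    Real.sin (((m : ℝ) + 1) * π * a / a) = 0 := by
  rw [mul_div_cancel_right₀ _ ha]
  exact_mod_cast Real.sin_nat_mul_pi (m + 1)

/-- **The lateral surfaces of the cantilever beam are traction free:**
`σ_xz(±a, y) = 0` for `y ∈ [−b, b]` and `σ_yz(x, ±b) = 0` for `x ∈ [−a, a]`. -/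
theorem beam_lateral_traction_free (F a b ν II : ℝ) (ha : 0 < a) (hb : 0 < b)
    (hν₁ : 0 < ν) (hν₂ : ν < 1) (hII : II = 4 * a * b ^ 3 / 3) :
    (∀ y ∈ Set.Icc (-b) b,
      beamSxz F II a b ν a y = 0 ∧ beamSxz F II a b ν (-a) y = 0) ∧
    (∀ x ∈ Set.Icc (-a) a,
      beamSyz F II a b ν x b = 0 ∧ beamSyz F II a b ν x (-b) = 0) := by
  refine ⟨fun y _ => ⟨?_, ?_⟩, fun x hx => ?_⟩
  · simp [beamSxz, sin_natCast_add_one_mul_pi_mul_div_self ha.ne']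
  · simp [beamSxz, mul_neg, neg_div, sin_natCast_add_one_mul_pi_mul_div_self ha.ne']
  · have h : beamSyz F II a b ν x b = 0 := by
      simp only [beamSyz, mul_div_cancel_right₀ _ (Real.cosh_pos _).ne',
        (hasSum_neg_one_pow_div_sq_mul_cos ha hx).tsum_eq]
      field_simp
      ring
    refine ⟨h, ?_⟩
    rw [← h]
    simp only [beamSyz, mul_neg, neg_div, Real.cosh_neg, neg_sq]
end

section
/- Let F ∈ ℝ, a > 0, b > 0, 0 < ν < 1, I = 4ab³/3, and let σ_xz, σ_yz be the cantilever beam shear stress field. Then the resultant shear force over the cross-section equals the applied load: ∫_{−b}^{b} ∫_{−a}^{a} σ_yz(x,y) dx dy = F and ∫_{−b}^{b} ∫_{−a}^{a} σ_xz(x,y) dx dy = 0. -/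
open Real

lemma norm_beamSyz_term_le (a b x y : ℝ) (ha : 0 < a) (hy : |y| ≤ |b|) (m : ℕ) :
    ‖((-1 : ℝ) ^ (m + 1) / ((m : ℝ) + 1) ^ 2) * Real.cos (((m : ℝ) + 1) * π * x / a) *
      Real.cosh (((m : ℝ) + 1) * π * y / a) / Real.cosh (((m : ℝ) + 1) * π * b / a)‖
      ≤ 1 / ((m : ℝ) + 1) ^ 2 := by
  have hcosh : Real.cosh (((m : ℝ) + 1) * π * y / a) /
      Real.cosh (((m : ℝ) + 1) * π * b / a) ≤ 1 := by
    rw [div_le_one (Real.cosh_pos _), Real.cosh_le_cosh]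
    simp only [abs_div, abs_mul]
    gcongr
  rw [mul_div_assoc, norm_mul, norm_mul, norm_div, norm_pow, norm_neg, norm_one, one_pow,
    Real.norm_of_nonneg (by positivity : (0 : ℝ) ≤ ((m : ℝ) + 1) ^ 2),
    Real.norm_of_nonneg (div_nonneg (Real.cosh_pos _).le (Real.cosh_pos _).le), mul_assoc]
  exact mul_le_of_le_one_right (by positivity)
    (mul_le_one₀ (Real.abs_cos_le_one _)
      (div_nonneg (Real.cosh_pos _).le (Real.cosh_pos _).le) hcosh)

lemma summable_one_div_nat_succ_sq : Summable fun m : ℕ => 1 / ((m : ℝ) + 1) ^ 2 := by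
  simpa using (summable_nat_add_iff 1).mpr (Real.summable_one_div_nat_pow.mpr one_lt_two)

lemma integral_cos_succ_mul_pi_div (a : ℝ) (ha : 0 < a) (m : ℕ) :
    ∫ x in (-a)..a, Real.cos (((m : ℝ) + 1) * π * x / a) = 0 := by
  have hc : ((m : ℝ) + 1) * π / a ≠ 0 := by positivity
  have hs : Real.sin (((m : ℝ) + 1) * π) = 0 := mod_cast Real.sin_nat_mul_pi (m + 1)
  have h : ∀ x : ℝ, ((m : ℝ) + 1) * π * x / a = ((m : ℝ) + 1) * π / a * x := fun x => by ring
  simp_rw [h]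
  rw [intervalIntegral.integral_comp_mul_left _ hc, integral_cos, mul_neg, Real.sin_neg,
    div_mul_cancel₀ _ ha.ne', hs]
  simp

lemma continuous_beamSyz_series (a b y : ℝ) (ha : 0 < a) (hy : |y| ≤ |b|) :
    Continuous fun x : ℝ => ∑' m : ℕ, ((-1 : ℝ) ^ (m + 1) / ((m : ℝ) + 1) ^ 2) *
      Real.cos (((m : ℝ) + 1) * π * x / a) *
      Real.cosh (((m : ℝ) + 1) * π * y / a) / Real.cosh (((m : ℝ) + 1) * π * b / a) :=
  continuous_tsum (fun m => by fun_prop) summable_one_div_nat_succ_sq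
    fun m x => norm_beamSyz_term_le a b x y ha hy m

lemma integral_beamSyz_series (a b y : ℝ) (ha : 0 < a) (hy : |y| ≤ |b|) :
    ∫ x in (-a)..a, ∑' m : ℕ, ((-1 : ℝ) ^ (m + 1) / ((m : ℝ) + 1) ^ 2) *
      Real.cos (((m : ℝ) + 1) * π * x / a) *
      Real.cosh (((m : ℝ) + 1) * π * y / a) / Real.cosh (((m : ℝ) + 1) * π * b / a) = 0 := by
  have hsum := intervalIntegral.hasSum_integral_of_dominated_convergence
    (μ := MeasureTheory.volume) (a := -a) (b := a)
    (F := fun (m : ℕ) (x : ℝ) => ((-1 : ℝ) ^ (m + 1) / ((m : ℝ) + 1) ^ 2) *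
      Real.cos (((m : ℝ) + 1) * π * x / a) *
      Real.cosh (((m : ℝ) + 1) * π * y / a) / Real.cosh (((m : ℝ) + 1) * π * b / a))
    (fun m _ => 1 / ((m : ℝ) + 1) ^ 2)
    (fun m => Continuous.aestronglyMeasurable (by fun_prop))
    (fun m => .of_forall fun x _ => norm_beamSyz_term_le a b x y ha hy m)
    (.of_forall fun _ _ => summable_one_div_nat_succ_sq)
    intervalIntegrable_const
    (.of_forall fun x _ => (summable_one_div_nat_succ_sq.of_norm_bounded
      fun m => norm_beamSyz_term_le a b x y ha hy m).hasSum)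
  simp only [intervalIntegral.integral_div, intervalIntegral.integral_mul_const,
    intervalIntegral.integral_const_mul, integral_cos_succ_mul_pi_div a ha, mul_zero, zero_mul,
    zero_div] at hsum
  exact hsum.unique hasSum_zero

lemma integral_beamSyz (F II a b ν y : ℝ) (ha : 0 < a) (hy : |y| ≤ |b|) :
    ∫ x in (-a)..a, beamSyz F II a b ν x y = F / II * a * (b ^ 2 - y ^ 2) := by
  have hcont := continuous_beamSyz_series a b y ha hy
  have hpoly : ∫ x in (-a)..a, (3 * x ^ 2 - a ^ 2) / 6 = 0 := by
    rw [intervalIntegral.integral_div, intervalIntegral.integral_sub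
      (Continuous.intervalIntegrable (by fun_prop) _ _) intervalIntegrable_const,
      intervalIntegral.integral_const_mul, integral_pow, intervalIntegral.integral_const]
    simp only [smul_eq_mul]
    push_cast
    ring
  unfold beamSyz
  rw [intervalIntegral.integral_add intervalIntegrable_const
      (Continuous.intervalIntegrable (by fun_prop) _ _),
    intervalIntegral.integral_const, intervalIntegral.integral_const_mul,
    intervalIntegral.integral_sub (Continuous.intervalIntegrable (by fun_prop) _ _)
      (Continuous.intervalIntegrable (by fun_prop) _ _),
    intervalIntegral.integral_const_mul, integral_beamSyz_series a b y ha hy, hpoly]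
  simp only [smul_eq_mul]
  ring

lemma beamSxz_neg_left (F II a b ν x y : ℝ) :
    beamSxz F II a b ν (-x) y = -beamSxz F II a b ν x y := by
  simp only [beamSxz, mul_neg, neg_div, Real.sin_neg, neg_mul, tsum_neg]

lemma integral_beamSxz (F II a b ν y : ℝ) :
    ∫ x in (-a)..a, beamSxz F II a b ν x y = 0 := by
  have h := intervalIntegral.integral_comp_neg (a := -a) (b := a)
    fun x => beamSxz F II a b ν x y
  simp only [beamSxz_neg_left, intervalIntegral.integral_neg, neg_neg] at h
  linarith

/-- **The resultant shear force over the beam cross-section equals the applied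
load:** `∫∫ σ_yz dx dy = F` and `∫∫ σ_xz dx dy = 0`. -/
theorem beam_shear_resultant (F a b ν II : ℝ) (ha : 0 < a) (hb : 0 < b)
    (hν₁ : 0 < ν) (hν₂ : ν < 1) (hII : II = 4 * a * b ^ 3 / 3) :
    (∫ y in (-b)..b, ∫ x in (-a)..a, beamSyz F II a b ν x y) = F ∧
    (∫ y in (-b)..b, ∫ x in (-a)..a, beamSxz F II a b ν x y) = 0 := by
  refine ⟨?_, by simp only [integral_beamSxz, intervalIntegral.integral_zero]⟩
  have hinner : Set.EqOn (fun y => ∫ x in (-a)..a, beamSyz F II a b ν x y)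
      (fun y => F / II * a * (b ^ 2 - y ^ 2)) (Set.uIcc (-b) b) := by
    intro y hy
    rw [Set.uIcc_of_le (by linarith)] at hy
    exact integral_beamSyz F II a b ν y ha ((abs_le.mpr hy).trans (le_abs_self b))
  rw [intervalIntegral.integral_congr hinner, intervalIntegral.integral_const_mul,
    intervalIntegral.integral_sub intervalIntegrable_const
      (Continuous.intervalIntegrable (by fun_prop) _ _),
    intervalIntegral.integral_const, integral_pow, hII]
  simp only [smul_eq_mul]
  field_simp
  push_cast
  ring
end

section
/- Let F ∈ ℝ, a > 0, b > 0, E > 0, 0 < ν < 1/2, I = 4ab³/3, μ = E/(2(1+ν)), λ = Eν/((1+ν)(1−2ν)), and let (u_x, u_y, u_z) be the cantilever beam displacement field. Define the linearized strain ε(u) = (∇u + ∇uᵀ)/2 and the stress by Hooke's law σ(u) = 2μ ε(u) + λ tr(ε(u)) Id. Then at every interior point of the beam (−a,a) × (−b,b) × ℝ the components σ_xx, σ_yy and σ_xy of σ(u) all vanish, and σ_zz = (F/I)·y·z. -/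
open Real

/-- Cantilever beam displacement component `u_x`; `II = 4ab³/3`. -/
noncomputable def beamUx (F E ν II : ℝ) (x y z : ℝ) : ℝ :=
  -(F * ν / (E * II)) * x * y * z

/-- Cantilever beam displacement component `u_y`. -/
noncomputable def beamUy (F E ν II : ℝ) (x y z : ℝ) : ℝ :=
  F / (E * II) * (ν / 2 * (x ^ 2 - y ^ 2) * z - z ^ 3 / 6)

/-- Cantilever beam displacement component `u_z` (series solution). -/
noncomputable def beamUz (F E ν II a b : ℝ) (x y z : ℝ) : ℝ :=
  F / (E * II) *
    (1 / 2 * y * (ν * x ^ 2 + z ^ 2) + 1 / 6 * ν * y ^ 3 +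
      (1 + ν) * (b ^ 2 * y - 1 / 3 * y ^ 3) - 1 / 3 * a ^ 2 * ν * y -
      4 * a ^ 3 * ν / π ^ 3 *
        ∑' m : ℕ, ((-1 : ℝ) ^ (m + 1) / ((m : ℝ) + 1) ^ 3) *
          Real.cos (((m : ℝ) + 1) * π * x / a) *
          Real.sinh (((m : ℝ) + 1) * π * y / a) / Real.cosh (((m : ℝ) + 1) * π * b / a))

theorem hasDerivAt_beamUx_fst (F E ν II x y z : ℝ) :
    HasDerivAt (fun s => beamUx F E ν II s y z) (-(F * ν / (E * II)) * y * z) x := by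
  simpa [beamUx] using
    (((hasDerivAt_id' x).const_mul (-(F * ν / (E * II)))).mul_const y).mul_const z

theorem hasDerivAt_beamUx_snd (F E ν II x y z : ℝ) :
    HasDerivAt (fun t => beamUx F E ν II x t z) (-(F * ν / (E * II)) * x * z) y := by
  simpa [beamUx] using
    ((hasDerivAt_id' y).const_mul (-(F * ν / (E * II)) * x)).mul_const z

theorem hasDerivAt_beamUy_fst (F E ν II x y z : ℝ) :
    HasDerivAt (fun s => beamUy F E ν II s y z) (F / (E * II) * (ν * x * z)) x := by
  unfold beamUy
  refine HasDerivAt.congr_deriv ((((((hasDerivAt_pow 2 x).sub_const (y ^ 2)).const_mul (ν / 2)).mul_const z).sub_const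
    (z ^ 3 / 6)).const_mul (F / (E * II))) ?_
  push_cast
  ring

theorem hasDerivAt_beamUy_snd (F E ν II x y z : ℝ) :
    HasDerivAt (fun t => beamUy F E ν II x t z) (-(F / (E * II) * (ν * y * z))) y := by
  unfold beamUy
  refine HasDerivAt.congr_deriv ((((((hasDerivAt_pow 2 y).const_sub (x ^ 2)).const_mul (ν / 2)).mul_const z).sub_const
    (z ^ 3 / 6)).const_mul (F / (E * II))) ?_
  push_cast
  ring

/-- The series in `u_z` does not depend on `z`, so only the polynomial part contributes. -/
theorem hasDerivAt_beamUz_thd (F E ν II a b x y z : ℝ) :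
    HasDerivAt (fun u => beamUz F E ν II a b x y u) (F / (E * II) * (y * z)) z := by
  unfold beamUz
  refine HasDerivAt.const_mul _ ?_
  refine HasDerivAt.sub_const _ (HasDerivAt.sub_const _ (HasDerivAt.add_const _
    (HasDerivAt.add_const _ ?_)))
  refine HasDerivAt.congr_deriv (((hasDerivAt_pow 2 z).const_add (ν * x ^ 2)).const_mul (1 / 2 * y)) ?_
  push_cast
  ring

/-- **Normal stresses of the cantilever beam displacement field via Hooke's law:**
with `ε(u) = (∇u + ∇uᵀ)/2` and `σ(u) = 2μ ε(u) + λ tr(ε(u)) Id`, at every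
interior point of the beam the components `σ_xx`, `σ_yy`, `σ_xy` vanish and
`σ_zz = (F/I)·y·z`. -/
theorem beam_displacement_normal_stresses
    (F a b E ν II μ lam : ℝ) (ha : 0 < a) (hb : 0 < b) (hE : 0 < E)
    (hν₁ : 0 < ν) (hν₂ : ν < 1 / 2) (hII : II = 4 * a * b ^ 3 / 3)
    (hμ : μ = E / (2 * (1 + ν)))
    (hlam : lam = E * ν / ((1 + ν) * (1 - 2 * ν)))
    (x y z : ℝ) (hx : x ∈ Set.Ioo (-a) a) (hy : y ∈ Set.Ioo (-b) b) :
    2 * μ * deriv (fun s => beamUx F E ν II s y z) x +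
        lam * (deriv (fun s => beamUx F E ν II s y z) x +
          deriv (fun t => beamUy F E ν II x t z) y +
          deriv (fun u => beamUz F E ν II a b x y u) z) = 0 ∧
    2 * μ * deriv (fun t => beamUy F E ν II x t z) y +
        lam * (deriv (fun s => beamUx F E ν II s y z) x +
          deriv (fun t => beamUy F E ν II x t z) y +
          deriv (fun u => beamUz F E ν II a b x y u) z) = 0 ∧
    μ * (deriv (fun t => beamUx F E ν II x t z) y +
        deriv (fun s => beamUy F E ν II s y z) x) = 0 ∧
    2 * μ * deriv (fun u => beamUz F E ν II a b x y u) z +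
        lam * (deriv (fun s => beamUx F E ν II s y z) x +
          deriv (fun t => beamUy F E ν II x t z) y +
          deriv (fun u => beamUz F E ν II a b x y u) z) = F / II * y * z := by
  have hII0 : II ≠ 0 := by rw [hII]; positivity
  have hE0 : E ≠ 0 := hE.ne'
  have h₁ : 1 + ν ≠ 0 := by linarith
  have h₂ : 1 - 2 * ν ≠ 0 := by linarith
  rw [(hasDerivAt_beamUx_fst F E ν II x y z).deriv, (hasDerivAt_beamUx_snd F E ν II x y z).deriv,
    (hasDerivAt_beamUy_fst F E ν II x y z).deriv, (hasDerivAt_beamUy_snd F E ν II x y z).deriv,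
    (hasDerivAt_beamUz_thd F E ν II a b x y z).deriv, hμ, hlam]
  clear hII hμ hlam
  refine ⟨?_, ?_, ?_, ?_⟩ <;> field_simp <;> ring
end
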